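/- arXiv:2112.00058 — 2 statements merged into one kernel-verified Lean document; each statement's English description precedes it below -/
import Mathlib

section
/- Let α ∈ ℂ be such that 1, α, α² are linearly independent over ℚ, and let N be a nonzero integer. Then the set { z ∈ ℂ : for all a, b ∈ ℤ there exist c, d ∈ ℤ with z·(a + b·α) = c + d·(N·α) } is exactly { N·d : d ∈ ℤ }; in particular it is an infinite cyclic additive subgroup of ℂ. -/
/-- An integral relation between `ℚ`-linearly independent `1, α, α²` is trivial. -/
theorem int_coeffs_eq_zero_of_linearIndependent {α : ℂ}
    (hα : LinearIndependent ℚ ![1, α, α ^ 2]) {p q r : ℤ}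
    (h : (p : ℂ) + q * α + r * α ^ 2 = 0) : p = 0 ∧ q = 0 ∧ r = 0 := by
  have key := Fintype.linearIndependent_iff.mp hα ![(p : ℚ), q, r] (by
    simpa [Fin.sum_univ_three, Algebra.smul_def] using h)
  exact ⟨by simpa using key 0, by simpa using key 1, by simpa using key 2⟩

/-- If `1, α, α²` are linearly independent over `ℚ` and `N ≠ 0`, then the set of
complex numbers `z` with `z·(ℤ + ℤα) ⊆ ℤ + ℤNα` is exactly `{N·d : d ∈ ℤ}`. -/
theorem stmt_4 (α : ℂ) (hα : LinearIndependent ℚ ![1, α, α ^ 2])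
    (N : ℤ) (hN : N ≠ 0) :
    {z : ℂ | ∀ a b : ℤ, ∃ c d : ℤ,
        z * ((a : ℂ) + (b : ℂ) * α) = (c : ℂ) + (d : ℂ) * ((N : ℂ) * α)}
      = {z : ℂ | ∃ d : ℤ, z = (N : ℂ) * (d : ℂ)} := by
  ext z
  simp only [Set.mem_ofPred_eq]
  constructor
  · intro h
    obtain ⟨c, d, h1⟩ := h 1 0
    obtain ⟨e, f, h2⟩ := h 0 1
    push_cast at h1 h2
    obtain ⟨-, hc, hd⟩ := int_coeffs_eq_zero_of_linearIndependent hα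
      (p := -e) (q := c - f * N) (r := d * N) (by
        push_cast
        linear_combination h2 - α * h1)
    obtain rfl : d = 0 := (mul_eq_zero.mp hd).resolve_right hN
    obtain rfl : c = f * N := sub_eq_zero.mp hc
    refine ⟨f, ?_⟩
    push_cast at h1
    linear_combination h1
  · rintro ⟨d, rfl⟩ a b
    refine ⟨N * d * a, d * b, ?_⟩
    push_cast
    ring
end

section
/- For every positive integer N there exists a complex number α with Im(α) > 0 such that the additive group { z ∈ ℂ : for all a, b ∈ ℤ there exist c, d ∈ ℤ with z·(a + b·α) = c + d·(N·α) } is exactly { N·d : d ∈ ℤ }, hence is isomorphic as an additive group to ℤ. -/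
/-- An element of infinite additive order in a torsion-free group generates a copy of `ℤ`. -/
theorem AddSubgroup.nonempty_zmultiples_addEquiv_int {G : Type*} [AddGroup G]
    [IsAddTorsionFree G] {x : G} (hx : x ≠ 0) :
    Nonempty (AddSubgroup.zmultiples x ≃+ ℤ) := by
  let f : ℤ →+ AddSubgroup.zmultiples x :=
    zmultiplesHom _ ⟨x, AddSubgroup.mem_zmultiples x⟩
  refine ⟨(AddEquiv.ofBijective f ⟨fun m n h => ?_, ?_⟩).symm⟩
  · have h' : m • x = n • x := congrArg Subtype.val h
    exact injective_zsmul_iff_not_isOfFinAddOrder.2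
      (not_isOfFinAddOrder_of_isAddTorsionFree hx) h'
  · rintro ⟨_, n, rfl⟩
    exact ⟨n, rfl⟩

/-- `√2` satisfies no nontrivial linear relation over `ℤ`. -/
theorem Int.eq_zero_of_mul_sqrt_two_eq {m n : ℤ} (h : (m : ℝ) * √2 = n) : m = 0 := by
  by_contra hm
  exact (irrational_sqrt_two.intCast_mul hm).ne_int n h


/-- For every positive integer `N` there exists `α` in the upper half plane such
that `{ z : z·(ℤ + ℤα) ⊆ ℤ + ℤNα } = { N·d : d ∈ ℤ }`, an additive subgroup of
`ℂ` isomorphic to `ℤ`. -/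
theorem stmt_12 (N : ℤ) (hN : 0 < N) :
    ∃ α : ℂ, 0 < α.im ∧
      ({z : ℂ | ∀ a b : ℤ, ∃ c d : ℤ,
          z * ((a : ℂ) + (b : ℂ) * α) = (c : ℂ) + (d : ℂ) * ((N : ℂ) * α)}
        = {z : ℂ | ∃ d : ℤ, z = (N : ℂ) * (d : ℂ)}) ∧
      Nonempty (AddSubgroup.zmultiples ((N : ℂ)) ≃+ ℤ) := by
  refine ⟨⟨√2, 1⟩, one_pos, ?_,
    AddSubgroup.nonempty_zmultiples_addEquiv_int (Int.cast_ne_zero.mpr hN.ne')⟩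
  ext z
  simp only [Set.mem_ofPred_eq]
  constructor
  · intro h
    obtain ⟨c, d, h₁⟩ := h 1 0
    obtain ⟨c', d', h₂⟩ := h 0 1
    simp only [Int.cast_one, Int.cast_zero, zero_mul, add_zero, mul_one] at h₁
    rw [h₁] at h₂ ⊢
    have him := congrArg Complex.im h₂
    simp at him
    have hd : 2 * (d * N) = 0 := by
      refine Int.eq_zero_of_mul_sqrt_two_eq (n := d' * N - c) ?_
      push_cast
      linarith
    have hd0 : d = 0 := by
      simpa [hN.ne'] using hd
    subst hd0
    have hc : c = N * d' := by
      have : (c : ℝ) = N * d' := by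
        simp at him
        linarith
      exact_mod_cast this
    exact ⟨d', by simp [hc]⟩
  · rintro ⟨d, rfl⟩ a b
    exact ⟨N * d * a, d * b, by push_cast; ring⟩
end
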